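/- Let l ≥ 2. Let b : Fin n → (d-dimensional little cubes) be a configuration with pairwise disjoint interiors, and for each i : Fin n let c^i : Fin (m i) → (d-dimensional little cubes) be a non-(l)-overlapping configuration. Then the combined family of little cubes ((b i) ∘ (c^i j)), indexed by the sigma type Σ (i : Fin n), Fin (m i), is non-(l)-overlapping. (This is the well-definedness of the left C_d-module structure γ_l : C_d(n) × C_d^{(l)}(m_1) × ⋯ × C_d^{(l)}(m_n) → C_d^{(l)}(m_1 + ⋯ + m_n) of the non-(l)-overlapping little cubes bimodule.) -/

import Mathlib

/-- The closed unit cube `K_d ⊆ ℝ^d`. -/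
def unitCube (d : ℕ) : Set (Fin d → ℝ) := {t | ∀ i, 0 ≤ t i ∧ t i ≤ 1}

/-- A `d`-dimensional little cube. -/
def IsLittleCube (d : ℕ) (c : (Fin d → ℝ) → (Fin d → ℝ)) : Prop :=
  ∃ a b : Fin d → ℝ, (∀ i, 0 < b i) ∧ (∀ t i, c t i = a i + b i * t i) ∧
    ∀ t ∈ unitCube d, c t ∈ unitCube d

/-- The image of a little cube. -/
def Im {d : ℕ} (c : (Fin d → ℝ) → (Fin d → ℝ)) : Set (Fin d → ℝ) :=
  c '' unitCube d

/-- A configuration of little cubes indexed by `J` is non-`(l)`-overlapping if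
any `l` distinct cube interiors have empty intersection. -/
def NonOverlapping (d l : ℕ) {J : Type*}
    (c : J → (Fin d → ℝ) → (Fin d → ℝ)) : Prop :=
  ∀ σ : Fin l → J, Function.Injective σ →
    (⋂ j : Fin l, interior (Im (c (σ j)))) = ∅

/-- A little cube is a homeomorphism of the ambient space. -/
theorem IsLittleCube.isHomeomorph {d : ℕ} {c : (Fin d → ℝ) → (Fin d → ℝ)}
    (hc : IsLittleCube d c) : IsHomeomorph c := by
  obtain ⟨a, b, hpos, hab, -⟩ := hc
  have hc_eq : c = fun t i => a i + b i * t i := funext fun t => funext (hab t)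
  rw [isHomeomorph_iff_exists_inverse]
  refine ⟨by rw [hc_eq]; fun_prop, fun t i => (b i)⁻¹ * (t i - a i), fun t => ?_, fun t => ?_,
    by fun_prop⟩
  · ext i
    simp [hab, (hpos i).ne']
  · ext i
    simp [hab, (hpos i).ne']

theorem IsLittleCube.Im_comp_subset {d : ℕ} {c : (Fin d → ℝ) → (Fin d → ℝ)}
    (hc : IsLittleCube d c) (b : (Fin d → ℝ) → (Fin d → ℝ)) : Im (b ∘ c) ⊆ Im b := by
  obtain ⟨-, -, -, -, hmaps⟩ := hc
  rintro _ ⟨t, ht, rfl⟩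
  exact ⟨c t, hmaps t ht, rfl⟩

theorem IsLittleCube.interior_Im_comp {d : ℕ} {b : (Fin d → ℝ) → (Fin d → ℝ)}
    (hb : IsLittleCube d b) (c : (Fin d → ℝ) → (Fin d → ℝ)) :
    interior (Im (b ∘ c)) = b '' interior (Im c) := by
  rw [Im, Set.image_comp]
  exact (hb.isHomeomorph.homeomorph.image_interior (Im c)).symm

/-- the left `C_d`-module structure on the non-`(l)`-overlapping
little cubes bimodule is well defined. -/
theorem nonOverlapping_comp_left {d n l : ℕ} (hl : 2 ≤ l) {m : Fin n → ℕ}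
    (b : Fin n → (Fin d → ℝ) → (Fin d → ℝ))
    (hb : ∀ j, IsLittleCube d (b j))
    (hdisj : ∀ j k : Fin n, j ≠ k →
      interior (Im (b j)) ∩ interior (Im (b k)) = ∅)
    (c : ∀ i : Fin n, Fin (m i) → (Fin d → ℝ) → (Fin d → ℝ))
    (hc : ∀ i j, IsLittleCube d (c i j))
    (hcl : ∀ i, NonOverlapping d l (c i)) :
    NonOverlapping d l
      (fun p : Σ i : Fin n, Fin (m i) => b p.1 ∘ c p.1 p.2) := by
  intro σ hσ
  rw [Set.eq_empty_iff_forall_notMem]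
  intro x hx
  rw [Set.mem_iInter] at hx
  have hfst : ∀ j k, (σ j).1 = (σ k).1 := by
    intro j k
    by_contra hne
    have hmem : x ∈ interior (Im (b (σ j).1)) ∩ interior (Im (b (σ k).1)) :=
      ⟨interior_mono ((hc _ _).Im_comp_subset _) (hx j),
        interior_mono ((hc _ _).Im_comp_subset _) (hx k)⟩
    rw [hdisj _ _ hne] at hmem
    exact hmem
  obtain ⟨i, hi⟩ : ∃ i, ∀ j, (σ j).1 = i := ⟨(σ ⟨0, by omega⟩).1, fun j => hfst j _⟩
  have hτ : ∀ j, ∃ k : Fin (m i), σ j = ⟨i, k⟩ := by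
    intro j
    obtain rfl := hi j
    exact ⟨(σ j).2, rfl⟩
  choose τ hτ using hτ
  have hτ_inj : Function.Injective τ := fun j k h => hσ (by rw [hτ, hτ, h])
  obtain ⟨y, rfl⟩ := (hb i).isHomeomorph.surjective x
  refine Set.eq_empty_iff_forall_notMem.mp (hcl i τ hτ_inj) y (Set.mem_iInter.mpr fun j => ?_)
  have hj := hx j
  rw [hτ j, (hb i).interior_Im_comp] at hj
  exact (hb i).isHomeomorph.injective.mem_set_image.mp hj
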